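/- Let Ω ⊆ ℝ^d be a bounded connected open set, let x₀ ∈ Ω, and let (P_n) be a sequence of open sets such that for every n: x₀ ∈ P_n, the closure of P_n is contained in Ω, and every y ∈ ∂P_n satisfies dist(y, ∂Ω) < 2^{-n}. Suppose that for each n, (ω^n_z)_{z∈P_n} is a family of Borel probability measures supported on ∂P_n such that for every continuous g : ℝ^d → ℝ, the function z ↦ ∫ g dω^n_z is harmonic on P_n and extends continuously to the closure of P_n with value g(ζ) at each ζ ∈ ∂P_n. Suppose that (ω_z)_{z∈Ω} is a family of Borel probability measures supported on ∂Ω such that for every C²-smooth g : ℝ^d → ℝ with Δg ≥ 0, the function G(z) := ∫ g dω_z is harmonic on Ω, satisfies G ≥ g on Ω, and satisfies G ≤ v on Ω for every harmonic v on Ω with v ≥ g on Ω. Then for every x ∈ Ω (which belongs to P_n for all sufficiently large n) and every continuous f : ℝ^d → ℝ, ∫ f dω^n_x → ∫ f dω_x as n → ∞. -/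

import Mathlib

open MeasureTheory
open scoped BigOperators

/-- The Laplacian of `u : ℝ^d → ℝ` at `x`: the sum of the pure second partial derivatives. -/
noncomputable def lapl {d : ℕ} (u : EuclideanSpace ℝ (Fin d) → ℝ)
    (x : EuclideanSpace ℝ (Fin d)) : ℝ :=
  ∑ i : Fin d, iteratedFDeriv ℝ 2 u x ![EuclideanSpace.single i (1:ℝ), EuclideanSpace.single i 1]

/-- `u` is harmonic on `s`: it is `C²`-smooth there and its Laplacian vanishes on `s`. -/
def HarmonicOnE {d : ℕ} (u : EuclideanSpace ℝ (Fin d) → ℝ)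
    (s : Set (EuclideanSpace ℝ (Fin d))) : Prop :=
  ContDiffOn ℝ 2 u s ∧ ∀ x ∈ s, lapl u x = 0


open Filter Topology Set InnerProductSpace Metric

theorem lapl_eq_basis {d : ℕ} (u : EuclideanSpace ℝ (Fin d) → ℝ)
    (b : OrthonormalBasis (Fin d) ℝ (EuclideanSpace ℝ (Fin d))) (x : EuclideanSpace ℝ (Fin d)) :
    lapl u x = ∑ i, iteratedFDeriv ℝ 2 u x ![b i, b i] := by
  have h1 := congrFun (laplacian_eq_iteratedFDeriv_orthonormalBasis u b) x
  have h2 := congrFun (laplacian_eq_iteratedFDeriv_orthonormalBasis u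
    (EuclideanSpace.basisFun (Fin d) ℝ)) x
  rw [← h1, h2]
  simp [lapl]

theorem line_deriv2 {E : Type*} [NormedAddCommGroup E] [NormedSpace ℝ E]
    {u : E → ℝ} {x : E} (hu : ContDiffAt ℝ 2 u x) (e : E) :
    (∀ᶠ t : ℝ in 𝓝 0, HasDerivAt (fun t : ℝ => u (x + t • e)) (fderiv ℝ u (x + t • e) e) t) ∧
    HasDerivAt (deriv (fun t : ℝ => u (x + t • e))) (iteratedFDeriv ℝ 2 u x ![e, e]) 0 := by
  have hl : ∀ t : ℝ, HasDerivAt (fun t : ℝ => x + t • e) e t := by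
    intro t
    simpa using ((hasDerivAt_id t).smul_const e).const_add x
  have h1 : ∀ᶠ y in 𝓝 x, DifferentiableAt ℝ u y := by
    filter_upwards [hu.eventually (by simp)] with y hy
    exact hy.differentiableAt (by simp)
  have hc : Tendsto (fun t : ℝ => x + t • e) (𝓝 0) (𝓝 x) := by
    have := (hl 0).continuousAt.tendsto
    simpa using this
  have h2 : ∀ᶠ t : ℝ in 𝓝 0,
      HasDerivAt (fun t : ℝ => u (x + t • e)) (fderiv ℝ u (x + t • e) e) t := by
    filter_upwards [hc.eventually h1] with t ht
    exact ht.hasFDerivAt.comp_hasDerivAt t (hl t)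
  refine ⟨h2, ?_⟩
  have h3 : DifferentiableAt ℝ (fderiv ℝ u) x :=
    (hu.fderiv_right (m := 1) (by norm_num)).differentiableAt (by simp)
  have h4 : HasDerivAt (fun t : ℝ => fderiv ℝ u (x + t • e)) (fderiv ℝ (fderiv ℝ u) x e) 0 := by
    have h5 : HasFDerivAt (fderiv ℝ u) (fderiv ℝ (fderiv ℝ u) x) (x + (0:ℝ) • e) := by
      simpa using h3.hasFDerivAt
    exact h5.comp_hasDerivAt (0:ℝ) (hl 0)
  have h6 : HasDerivAt (fun t : ℝ => fderiv ℝ u (x + t • e) e)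
      (fderiv ℝ (fderiv ℝ u) x e e) 0 := by
    have := h4.clm_apply (hasDerivAt_const (0:ℝ) e)
    simpa using this
  rw [iteratedFDeriv_two_apply]
  refine HasDerivAt.congr_of_eventuallyEq (by simpa using h6) ?_
  filter_upwards [h2] with t ht
  exact ht.deriv

theorem iter2_nonpos_of_localMax {E : Type*} [NormedAddCommGroup E] [NormedSpace ℝ E]
    {u : E → ℝ} {x : E} (hu : ContDiffAt ℝ 2 u x) (hm : IsLocalMax u x) (e : E) :
    iteratedFDeriv ℝ 2 u x ![e, e] ≤ 0 := by
  by_contra! hpos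
  obtain ⟨h1, h2⟩ := line_deriv2 hu e
  have hc : Tendsto (fun t : ℝ => x + t • e) (𝓝 0) (𝓝 x) := by
    have : Continuous (fun t : ℝ => x + t • e) := by fun_prop
    simpa using this.tendsto 0
  have hmax : IsLocalMax (fun t : ℝ => u (x + t • e)) 0 := by
    have := hc.eventually hm
    simpa [IsLocalMax, IsMaxFilter] using this
  have hmin : IsLocalMin (fun t : ℝ => u (x + t • e)) 0 := by
    apply isLocalMin_of_deriv_deriv_pos
    · rw [h2.deriv]; exact hpos
    · exact hmax.deriv_eq_zero
    · exact h1.self_of_nhds.continuousAt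
  have hconst : (fun t : ℝ => u (x + t • e)) =ᶠ[𝓝 0] fun _ => u (x + (0:ℝ) • e) := by
    filter_upwards [hmax, hmin] with t h3 h4
    exact le_antisymm h3 h4
  have h5 := hconst.deriv.deriv_eq
  rw [h2.deriv] at h5
  simp at h5
  linarith

theorem lapl_nonpos_of_localMax {d : ℕ} {u : EuclideanSpace ℝ (Fin d) → ℝ}
    {x : EuclideanSpace ℝ (Fin d)} (hu : ContDiffAt ℝ 2 u x) (hm : IsLocalMax u x) :
    lapl u x ≤ 0 :=
  Finset.sum_nonpos fun _ _ => iter2_nonpos_of_localMax hu hm _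

theorem iter2_quadratic {E : Type*} [NormedAddCommGroup E] [NormedSpace ℝ E]
    {u : E → ℝ} {x : E} (hu : ContDiffAt ℝ 2 u x) (e : E) (a b c : ℝ)
    (h : ∀ t : ℝ, u (x + t • e) = a + b * t + c * t ^ 2) :
    iteratedFDeriv ℝ 2 u x ![e, e] = 2 * c := by
  obtain ⟨-, h2⟩ := line_deriv2 hu e
  have h3 : deriv (fun t : ℝ => u (x + t • e)) = fun t => b + c * (2 * t) := by
    ext t
    simp only [h]
    have : HasDerivAt (fun t : ℝ => a + b * t + c * t ^ 2) (b * 1 + c * (2 * t)) t := by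
      have := (((hasDerivAt_id t).const_mul b).const_add a).add
        (((hasDerivAt_id t).pow 2).const_mul c)
      simpa using! this
    rw [this.deriv]; ring
  rw [h3] at h2
  have h4 : HasDerivAt (fun t : ℝ => b + c * (2 * t)) (c * (2 * 1)) 0 :=
    (((hasDerivAt_id (0:ℝ)).const_mul 2).const_mul c).const_add b
  rw [h2.unique h4]; ring

theorem lapl_add {d : ℕ} {u v : EuclideanSpace ℝ (Fin d) → ℝ} {x : EuclideanSpace ℝ (Fin d)}
    (hu : ContDiffAt ℝ 2 u x) (hv : ContDiffAt ℝ 2 v x) :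
    lapl (fun y => u y + v y) x = lapl u x + lapl v x := by
  have : (fun y => u y + v y) = u + v := rfl
  simp [lapl, this, ← Finset.sum_add_distrib, iteratedFDeriv_add_apply hu hv]

theorem lapl_sub {d : ℕ} {u v : EuclideanSpace ℝ (Fin d) → ℝ} {x : EuclideanSpace ℝ (Fin d)}
    (hu : ContDiffAt ℝ 2 u x) (hv : ContDiffAt ℝ 2 v x) :
    lapl (fun y => u y - v y) x = lapl u x - lapl v x := by
  have : (fun y => u y - v y) = u - v := rfl
  simp [lapl, this, ← Finset.sum_sub_distrib, iteratedFDeriv_sub_apply hu hv]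

theorem lapl_congr {d : ℕ} {u v : EuclideanSpace ℝ (Fin d) → ℝ} {x : EuclideanSpace ℝ (Fin d)}
    (h : u =ᶠ[𝓝 x] v) : lapl u x = lapl v x := by
  have := (EventuallyEq.iteratedFDeriv ℝ h 2).self_of_nhds
  simp [lapl, this]

/-- The barrier. -/
noncomputable def barr {d : ℕ} (e : EuclideanSpace ℝ (Fin d)) (A B r : ℝ)
    (x : EuclideanSpace ℝ (Fin d)) : ℝ :=
  A * ‖x‖ ^ 2 + B * (r * inner ℝ e x - (inner ℝ e x) ^ 2)

theorem barr_contDiff {d : ℕ} (e : EuclideanSpace ℝ (Fin d)) (A B r : ℝ) :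
    ContDiff ℝ 2 (barr e A B r) := by
  unfold barr
  have h1 : ContDiff ℝ 2 (fun x : EuclideanSpace ℝ (Fin d) => ‖x‖ ^ 2) := contDiff_norm_sq ℝ
  have h2 : ContDiff ℝ 2 (fun x : EuclideanSpace ℝ (Fin d) => (inner ℝ e x : ℝ)) :=
    contDiff_const.inner ℝ contDiff_id
  exact (contDiff_const.mul h1).add (contDiff_const.mul ((contDiff_const.mul h2).sub (h2.pow 2)))

theorem lapl_barr {d : ℕ} (e : EuclideanSpace ℝ (Fin d)) (A B r : ℝ)
    (x : EuclideanSpace ℝ (Fin d)) :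
    lapl (barr e A B r) x = 2 * d * A - 2 * B * ‖e‖ ^ 2 := by
  have h : ∀ v : EuclideanSpace ℝ (Fin d), iteratedFDeriv ℝ 2 (barr e A B r) x ![v, v]
      = 2 * (A * ‖v‖ ^ 2 - B * (inner ℝ e v) ^ 2) := by
    intro v
    refine iter2_quadratic (barr_contDiff e A B r).contDiffAt v (barr e A B r x)
      (A * (2 * inner ℝ x v) + B * (r * inner ℝ e v - 2 * inner ℝ e x * inner ℝ e v)) _ ?_
    intro t
    unfold barr
    rw [norm_add_sq_real, inner_add_right, inner_smul_right, inner_smul_right, norm_smul, mul_pow,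
      Real.norm_eq_abs, sq_abs]
    ring
  rw [lapl_eq_basis _ (EuclideanSpace.basisFun (Fin d) ℝ)]
  simp only [h]
  rw [← Finset.mul_sum, Finset.sum_sub_distrib, ← Finset.mul_sum, ← Finset.mul_sum,
    OrthonormalBasis.sum_sq_inner_left]
  simp
  ring

theorem lapl_comp {d : ℕ} (u : EuclideanSpace ℝ (Fin d) → ℝ)
    (ρ : EuclideanSpace ℝ (Fin d) ≃ₗᵢ[ℝ] EuclideanSpace ℝ (Fin d))
    (m x : EuclideanSpace ℝ (Fin d)) (hu : ContDiffAt ℝ 2 u (m + ρ x)) :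
    lapl (fun y => u (m + ρ y)) x = lapl u (m + ρ x) := by
  have hm : ContDiffAt ℝ 2 (fun y => m + ρ y) x :=
    contDiffAt_const.add ρ.contDiff.contDiffAt
  have h0 : ContDiffAt ℝ 2 (fun y => u (m + ρ y)) x :=
    ContDiffAt.comp x (f := fun y => m + ρ y) hu hm
  rw [lapl_eq_basis u ((EuclideanSpace.basisFun (Fin d) ℝ).map ρ),
    lapl_eq_basis _ (EuclideanSpace.basisFun (Fin d) ℝ)]
  refine Finset.sum_congr rfl fun i _ => ?_
  set v := EuclideanSpace.basisFun (Fin d) ℝ i with hv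
  have h1 := (line_deriv2 h0 v).2
  have h2 := (line_deriv2 hu (ρ v)).2
  have h3 : (fun t : ℝ => u (m + ρ (x + t • v))) = fun t : ℝ => u (m + ρ x + t • ρ v) := by
    ext t
    rw [map_add, map_smul, add_assoc]
  rw [h3] at h1
  rw [OrthonormalBasis.map_apply, h1.unique h2]

theorem max_principle {d : ℕ} (hd : 0 < d) {U : Set (EuclideanSpace ℝ (Fin d))} (hU : IsOpen U)
    (hb : Bornology.IsBounded U) {w : EuclideanSpace ℝ (Fin d) → ℝ} (hw : ContDiffOn ℝ 2 w U)
    (hl : ∀ x ∈ U, 0 ≤ lapl w x)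
    (hfr : ∀ ζ ∈ frontier U, ∃ c ≤ 0, Tendsto w (𝓝[U] ζ) (𝓝 c)) :
    ∀ x ∈ U, w x ≤ 0 := by
  by_contra! hcon
  obtain ⟨x₁, hx₁, hpos⟩ := hcon
  obtain ⟨R, hR0, hR⟩ : ∃ R : ℝ, 0 < R ∧ ∀ y ∈ closure U, ‖y‖ ≤ R :=
    hb.closure.exists_pos_norm_le
  set ε : ℝ := w x₁ / (2 * R ^ 2) with hε
  have hε0 : 0 < ε := by positivity
  have hεR : ε * R ^ 2 < w x₁ := by
    have : ε * R ^ 2 = w x₁ / 2 := by rw [hε]; field_simp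
    linarith
  set q : EuclideanSpace ℝ (Fin d) → ℝ := barr 0 ε 0 0 with hq
  have hqC : ContDiff ℝ 2 q := barr_contDiff 0 ε 0 0
  have hqv : ∀ y, q y = ε * ‖y‖ ^ 2 := by intro y; simp [hq, barr]
  set W : EuclideanSpace ℝ (Fin d) → ℝ := fun y => w y + q y with hW
  have hWat : ∀ y ∈ U, ContDiffAt ℝ 2 W y := fun y hy =>
    (hw.contDiffAt (hU.mem_nhds hy)).add hqC.contDiffAt
  set K : Set (EuclideanSpace ℝ (Fin d)) := {y | y ∈ U ∧ W x₁ ≤ W y} with hK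
  have hWx : w x₁ ≤ W x₁ := by
    simp only [hW, hqv]; nlinarith [sq_nonneg ‖x₁‖]
  have hKc : IsClosed K := by
    rw [← closure_subset_iff_isClosed]
    intro y hy
    have hyU : y ∈ closure U := closure_mono (fun z hz => hz.1) hy
    have hfreq : ∃ᶠ z in 𝓝 y, z ∈ K := mem_closure_iff_frequently.1 hy
    by_cases hyin : y ∈ U
    · refine ⟨hyin, ?_⟩
      by_contra! hlt
      have := (hWat y hyin).continuousAt.eventually (gt_mem_nhds hlt)
      obtain ⟨z, hz1, hz2⟩ := (hfreq.and_eventually this).exists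
      exact absurd hz1.2 (not_le.2 hz2)
    · exfalso
      have hyf : y ∈ frontier U := by
        rw [hU.frontier_eq]; exact ⟨hyU, hyin⟩
      obtain ⟨c, hc, ht⟩ := hfr y hyf
      have ht2 : Tendsto W (𝓝[U] y) (𝓝 (c + q y)) :=
        ht.add (hqC.continuous.tendsto y |>.mono_left nhdsWithin_le_nhds)
      have hlt : c + q y < W x₁ := by
        have h1 : ‖y‖ ^ 2 ≤ R ^ 2 := by
          have := hR y hyU
          gcongr
        have : q y ≤ ε * R ^ 2 := by rw [hqv]; gcongr
        linarith
      have := ht2.eventually (gt_mem_nhds hlt)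
      rw [eventually_nhdsWithin_iff] at this
      obtain ⟨z, hz1, hz2⟩ := (hfreq.and_eventually this).exists
      exact absurd hz1.2 (not_le.2 (hz2 hz1.1))
  have hKcomp : IsCompact K :=
    isCompact_of_isClosed_isBounded hKc (hb.subset fun z hz => hz.1)
  obtain ⟨y, hyK, hmax⟩ := hKcomp.exists_isMaxOn ⟨x₁, hx₁, le_rfl⟩
    (f := W) (fun y hy => (hWat y hy.1).continuousAt.continuousWithinAt)
  have hloc : IsLocalMax W y := by
    filter_upwards [hU.mem_nhds hyK.1] with z hz
    by_cases hzK : W x₁ ≤ W z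
    · exact hmax ⟨hz, hzK⟩
    · exact (not_le.1 hzK).le.trans hyK.2
  have h1 := lapl_nonpos_of_localMax (hWat y hyK.1) hloc
  have h2 : lapl W y = lapl w y + lapl q y :=
    lapl_add (hw.contDiffAt (hU.mem_nhds hyK.1)) hqC.contDiffAt
  have h3 : lapl q y = 2 * d * ε := by simp [hq, lapl_barr]
  have h4 := hl y hyK.1
  have h5 : (0:ℝ) < d := by exact_mod_cast hd
  have : 0 < 2 * d * ε := by positivity
  linarith

theorem comparison {d : ℕ} (hd : 0 < d) {U : Set (EuclideanSpace ℝ (Fin d))} (hU : IsOpen U)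
    (hb : Bornology.IsBounded U) {u v : EuclideanSpace ℝ (Fin d) → ℝ} (hu : ContDiffOn ℝ 2 u U)
    (hv : ContDiffOn ℝ 2 v U) (hl : ∀ x ∈ U, lapl v x ≤ lapl u x)
    (hfr : ∀ ζ ∈ frontier U, ∃ a b, a ≤ b ∧ Tendsto u (𝓝[U] ζ) (𝓝 a) ∧
      Tendsto v (𝓝[U] ζ) (𝓝 b)) :
    ∀ x ∈ U, u x ≤ v x := by
  intro x hx
  have := max_principle hd hU hb (w := fun y => u y - v y) (hu.sub hv) ?_ ?_ x hx
  · linarith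
  · intro y hy
    rw [lapl_sub (hu.contDiffAt (hU.mem_nhds hy)) (hv.contDiffAt (hU.mem_nhds hy))]
    linarith [hl y hy]
  · intro ζ hζ
    obtain ⟨a, b, hab, h1, h2⟩ := hfr ζ hζ
    exact ⟨a - b, by linarith, h1.sub h2⟩

theorem harm_core {d : ℕ} {U : Set (EuclideanSpace ℝ (Fin d))} (hU : IsOpen U)
    {u : EuclideanSpace ℝ (Fin d) → ℝ} (hu : HarmonicOnE u U) {m e : EuclideanSpace ℝ (Fin d)}
    {r M : ℝ} (hM : 0 < M) (hr : 0 < r) (hball : closedBall m r ⊆ U)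
    (hbd : ∀ y ∈ U, |u y| ≤ M) (he : ‖e‖ = 1) {t : ℝ} (ht0 : 0 ≤ t) (htr : t ≤ r) :
    u (m + t • e) - u (m - t • e) ≤ (d + 1) * (2 * M / r) * t := by
  set A : ℝ := 2 * M / r ^ 2 with hA
  have hA0 : 0 < A := by positivity
  have hAr : A * r ^ 2 = 2 * M := by rw [hA]; field_simp
  set B : ℝ := (d + 1) * A with hB
  have hB0 : 0 < B := by positivity
  set ρ := Submodule.reflection (ℝ ∙ e)ᗮ with hρ
  set K : Set (EuclideanSpace ℝ (Fin d)) := closedBall 0 r ∩ {y | 0 ≤ inner ℝ e y} with hK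
  set Φ : EuclideanSpace ℝ (Fin d) → ℝ := fun y => (u (m + y) - u (m + ρ y)) - barr e A B r y
    with hΦ
  have hmem : ∀ y : EuclideanSpace ℝ (Fin d), ‖y‖ ≤ r → m + y ∈ U := by
    intro y hy
    apply hball
    simpa [mem_closedBall, dist_eq_norm] using hy
  have hmem2 : ∀ y : EuclideanSpace ℝ (Fin d), ‖y‖ ≤ r → m + ρ y ∈ U := by
    intro y hy
    exact hmem _ (by rwa [LinearIsometryEquiv.norm_map])
  have huat : ∀ y ∈ U, ContDiffAt ℝ 2 u y := fun y hy => hu.1.contDiffAt (hU.mem_nhds hy)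
  have hC1 : ∀ y : EuclideanSpace ℝ (Fin d), ‖y‖ ≤ r → ContDiffAt ℝ 2 (fun y => u (m + y)) y := by
    intro y hy
    exact ContDiffAt.comp y (f := fun y => m + y) (huat _ (hmem y hy))
      (contDiffAt_const.add contDiffAt_id)
  have hC2 : ∀ y : EuclideanSpace ℝ (Fin d), ‖y‖ ≤ r →
      ContDiffAt ℝ 2 (fun y => u (m + ρ y)) y := by
    intro y hy
    exact ContDiffAt.comp y (f := fun y => m + ρ y) (huat _ (hmem2 y hy))
      (contDiffAt_const.add ρ.contDiff.contDiffAt)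
  have hΦC : ∀ y : EuclideanSpace ℝ (Fin d), ‖y‖ ≤ r → ContDiffAt ℝ 2 Φ y := by
    intro y hy
    exact ((hC1 y hy).sub (hC2 y hy)).sub (barr_contDiff e A B r).contDiffAt
  have hinner : Continuous fun y : EuclideanSpace ℝ (Fin d) => (inner ℝ e y : ℝ) := by fun_prop
  have hKcomp : IsCompact K :=
    (isCompact_closedBall _ _).inter_right (isClosed_le continuous_const hinner)
  have hte : t • e ∈ K := by
    constructor
    · simp [norm_smul, he, abs_of_nonneg ht0, htr]
    · simp [inner_smul_right, he, ht0]
  have hnK : ∀ y ∈ K, ‖y‖ ≤ r := fun y hy => by simpa using hy.1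
  obtain ⟨y, hyK, hmax⟩ := hKcomp.exists_isMaxOn ⟨_, hte⟩
    (f := Φ) (fun y hy => (hΦC y (hnK y hy)).continuousAt.continuousWithinAt)
  have hyr := hnK y hyK
  have hs0 : 0 ≤ inner ℝ e y := hyK.2
  have hsr : inner ℝ e y ≤ r := by
    have := real_inner_le_norm e y
    rw [he, one_mul] at this
    linarith
  have hΦy : Φ y ≤ 0 := by
    by_contra! hpos
    have hsprod : 0 ≤ r * inner ℝ e y - (inner ℝ e y) ^ 2 := by nlinarith
    rcases hs0.eq_or_lt with hs | hs
    · have hy : y ∈ (ℝ ∙ e)ᗮ := Submodule.mem_orthogonal_singleton_iff_inner_right.2 hs.symm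
      have : ρ y = y := Submodule.reflection_mem_subspace_eq_self hy
      simp only [hΦ, this, barr, ← hs] at hpos
      nlinarith [mul_nonneg hA0.le (sq_nonneg ‖y‖)]
    rcases hyr.eq_or_lt with hy | hy
    · have h1 := abs_le.1 (hbd _ (hmem y hyr))
      have h2 := abs_le.1 (hbd _ (hmem2 y hyr))
      simp only [hΦ, barr, hy, hAr] at hpos
      nlinarith [mul_nonneg hB0.le hsprod]
    · have hloc : IsLocalMax Φ y := by
        have e1 : ∀ᶠ z in 𝓝 y, ‖z‖ < r := continuous_norm.continuousAt.eventually (gt_mem_nhds hy)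
        have e2 : ∀ᶠ z in 𝓝 y, 0 < inner ℝ e z := hinner.continuousAt.eventually (lt_mem_nhds hs)
        filter_upwards [e1, e2] with z h1 h2
        exact hmax ⟨by simpa using h1.le, h2.le⟩
      have h1 := lapl_nonpos_of_localMax (hΦC y hyr) hloc
      have h2 : lapl Φ y = (lapl u (m + y) - lapl u (m + ρ y)) - lapl (barr e A B r) y := by
        rw [hΦ, lapl_sub ((hC1 y hyr).sub (hC2 y hyr)) (barr_contDiff e A B r).contDiffAt,
          lapl_sub (hC1 y hyr) (hC2 y hyr), lapl_comp u ρ m y (huat _ (hmem2 y hyr))]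
        congr 2
        exact lapl_comp u (LinearIsometryEquiv.refl ℝ _) m y (huat _ (hmem y hyr))
      rw [hu.2 _ (hmem y hyr), hu.2 _ (hmem2 y hyr), lapl_barr, he] at h2
      rw [h2, hB] at h1
      nlinarith
  have hfin : Φ (t • e) ≤ 0 := (hmax hte).trans hΦy
  have hre : ρ (t • e) = - (t • e) := by
    rw [map_smul, hρ, Submodule.reflection_orthogonalComplement_singleton_eq_neg, smul_neg]
  have hbarr : barr e A B r (t • e) = A * t ^ 2 + B * (r * t - t ^ 2) := by
    simp [barr, norm_smul, he, inner_smul_right]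
  simp only [hΦ, hre, hbarr, ← sub_eq_add_neg] at hfin
  have h1 : (d + 1) * (2 * M / r) * t = B * r * t := by
    rw [hB, hA]; field_simp
  have h2 : A * t ^ 2 ≤ B * t ^ 2 := by
    gcongr
    rw [hB]
    nlinarith [(Nat.cast_nonneg d : (0:ℝ) ≤ d)]
  rw [h1]
  linarith

theorem harm_lip {d : ℕ} {U : Set (EuclideanSpace ℝ (Fin d))} (hU : IsOpen U)
    {u : EuclideanSpace ℝ (Fin d) → ℝ} (hu : HarmonicOnE u U) {c : EuclideanSpace ℝ (Fin d)}
    {r M : ℝ} (hM : 0 < M) (hr : 0 < r) (hball : closedBall c (2 * r) ⊆ U)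
    (hbd : ∀ y ∈ U, |u y| ≤ M) {p q : EuclideanSpace ℝ (Fin d)} (hp : p ∈ closedBall c r)
    (hq : q ∈ closedBall c r) :
    u p - u q ≤ (d + 1) * (M / r) * ‖p - q‖ := by
  rcases eq_or_ne p q with rfl | hne
  · simp
  have hn : 0 < ‖p - q‖ := norm_pos_iff.2 (sub_ne_zero.2 hne)
  set m : EuclideanSpace ℝ (Fin d) := (1 / 2 : ℝ) • (p + q) with hm
  set e : EuclideanSpace ℝ (Fin d) := ‖p - q‖⁻¹ • (p - q) with he
  have he1 : ‖e‖ = 1 := by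
    rw [he, norm_smul, norm_inv, norm_norm, inv_mul_cancel₀ hn.ne']
  rw [mem_closedBall, dist_eq_norm] at hp hq
  have h1 : (‖p - q‖ / 2) • e = (1 / 2 : ℝ) • (p - q) := by
    rw [he, smul_smul]; congr 1; field_simp
  have hle : ‖p - q‖ ≤ 2 * r := by
    have : p - q = (p - c) - (q - c) := by abel
    rw [this]
    linarith [norm_sub_le (p - c) (q - c)]
  have hmc : ‖m - c‖ ≤ r := by
    have : m - c = (1 / 2 : ℝ) • ((p - c) + (q - c)) := by rw [hm]; module
    rw [this, norm_smul]
    have := norm_add_le (p - c) (q - c)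
    norm_num
    linarith
  have hb2 : closedBall m r ⊆ U := by
    refine Subset.trans (closedBall_subset_closedBall' ?_) hball
    rw [dist_eq_norm]; linarith
  have := harm_core hU hu hM hr hb2 hbd he1 (t := ‖p - q‖ / 2) (by positivity) (by linarith)
  have h2 : m + (‖p - q‖ / 2) • e = p := by rw [h1, hm]; module
  have h3 : m - (‖p - q‖ / 2) • e = q := by rw [h1, hm]; module
  rw [h2, h3] at this
  calc _ ≤ _ := this
    _ = _ := by field_simp

theorem approx_sub {d : ℕ} {K : Set (EuclideanSpace ℝ (Fin d))} (hK : Bornology.IsBounded K)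
    {f : EuclideanSpace ℝ (Fin d) → ℝ} (hf : Continuous f) {ε : ℝ} (hε : 0 < ε) :
    ∃ g₁ g₂ : EuclideanSpace ℝ (Fin d) → ℝ, ContDiff ℝ 2 g₁ ∧ ContDiff ℝ 2 g₂ ∧
      (∀ x, 0 ≤ lapl g₁ x) ∧ (∀ x, 0 ≤ lapl g₂ x) ∧ ∀ x ∈ K, |f x - (g₁ x - g₂ x)| ≤ ε := by
  obtain ⟨p, hp, hpf, -⟩ := hf.exists_contDiff_approx 2 (ε := fun _ => ε) continuous_const
    (fun _ => hε)
  obtain ⟨R, hR0, hR⟩ := hK.exists_pos_norm_le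
  let χ : ContDiffBump (0 : EuclideanSpace ℝ (Fin d)) := ⟨R, R + 1, hR0, by linarith⟩
  set q : EuclideanSpace ℝ (Fin d) → ℝ := fun x => χ x * p x with hq
  have hqC : ContDiff ℝ 2 q := χ.contDiff.mul hp
  have hqs : HasCompactSupport q := χ.hasCompactSupport.mul_right
  obtain ⟨C, hC⟩ := (hqC.continuous_iteratedFDeriv (m := 2) (by simp)).bounded_above_of_compact_support
    (hqs.iteratedFDeriv 2)
  have hC0 : 0 ≤ C := (norm_nonneg _).trans (hC 0)
  have hlq : ∀ x, - (d * C) ≤ lapl q x := by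
    intro x
    have : ∀ i : Fin d, -C ≤ iteratedFDeriv ℝ 2 q x
        ![EuclideanSpace.single i (1:ℝ), EuclideanSpace.single i 1] := by
      intro i
      have h1 := (iteratedFDeriv ℝ 2 q x).le_opNorm
        ![EuclideanSpace.single i (1:ℝ), EuclideanSpace.single i 1]
      simp [Fin.prod_univ_two] at h1
      have := hC x
      linarith [(abs_le.1 (h1.trans this)).1]
    have h2 := Finset.sum_le_sum fun i (_ : i ∈ Finset.univ) => this i
    simp at h2
    exact h2
  refine ⟨fun x => q x + barr 0 C 0 0 x, barr 0 C 0 0, hqC.add (barr_contDiff _ _ _ _),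
    barr_contDiff _ _ _ _, ?_, ?_, ?_⟩
  · intro x
    rw [lapl_add hqC.contDiffAt (barr_contDiff _ _ _ _).contDiffAt, lapl_barr]
    have := hlq x
    have : (0:ℝ) ≤ d * C := by positivity
    simp
    linarith
  · intro x
    rw [lapl_barr]
    simp
    positivity
  · intro x hx
    have h1 : χ x = 1 := χ.one_of_mem_closedBall (by simpa using! hR x hx)
    have h2 := hpf x
    rw [Real.dist_eq, abs_sub_comm] at h2
    simp only [hq, h1]
    simpa using h2.le

theorem prob_abs_le {X : Type*} [MeasurableSpace X] {μ : Measure X} (hμ : IsProbabilityMeasure μ)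
    {S : Set X} (hS : μ Sᶜ = 0) {φ : X → ℝ} {M : ℝ} (h : ∀ x ∈ S, |φ x| ≤ M) :
    |∫ x, φ x ∂μ| ≤ M := by
  have hae : ∀ᵐ x ∂μ, x ∈ S := hS
  have := norm_integral_le_of_norm_le_const (μ := μ) (f := φ) (C := M) (by
    filter_upwards [hae] with x hx
    exact h x hx)
  simpa using this

theorem prob_integrable {d : ℕ} {μ : Measure (EuclideanSpace ℝ (Fin d))}
    (hμ : IsProbabilityMeasure μ) {S : Set (EuclideanSpace ℝ (Fin d))} (hS : μ Sᶜ = 0)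
    (hb : Bornology.IsBounded S) {φ : EuclideanSpace ℝ (Fin d) → ℝ} (hφ : Continuous φ) :
    Integrable φ μ := by
  have hae : ∀ᵐ x ∂μ, x ∈ S := hS
  obtain ⟨M, hM⟩ := hb.isCompact_closure.exists_bound_of_continuousOn hφ.continuousOn
  refine Integrable.of_bound hφ.aestronglyMeasurable M ?_
  filter_upwards [hae] with x hx
  exact hM x (subset_closure hx)

theorem exhaust {d : ℕ} (hd : 0 < d)
    {Ω : Set (EuclideanSpace ℝ (Fin d))} (hΩopen : IsOpen Ω)
    (hΩbdd : Bornology.IsBounded Ω) (hΩconn : IsConnected Ω)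
    {x₀ : EuclideanSpace ℝ (Fin d)} (hx₀ : x₀ ∈ Ω)
    {P : ℕ → Set (EuclideanSpace ℝ (Fin d))} (hPopen : ∀ n, IsOpen (P n))
    (hx₀P : ∀ n, x₀ ∈ P n)
    (hPfr : ∀ n, ∀ y ∈ frontier (P n), Metric.infDist y (frontier Ω) < (2:ℝ) ^ (-(n:ℤ)))
    {K : Set (EuclideanSpace ℝ (Fin d))} (hK : IsCompact K) (hKΩ : K ⊆ Ω) :
    ∀ᶠ n in atTop, K ⊆ P n := by
  have hfrne : (frontier Ω).Nonempty := by
    rw [nonempty_iff_ne_empty]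
    intro h
    rcases frontier_eq_empty_iff.1 h with h | h
    · exact absurd (h ▸ hx₀) (notMem_empty _)
    · have : Nonempty (Fin d) := ⟨⟨0, hd⟩⟩
      exact NormedSpace.unbounded_univ ℝ (EuclideanSpace ℝ (Fin d)) (h ▸ hΩbdd)
  have hpow : Tendsto (fun n : ℕ => (2:ℝ) ^ (-(n:ℤ))) atTop (𝓝 0) := by
    have := tendsto_pow_atTop_nhds_zero_of_lt_one (r := (1/2 : ℝ)) (by norm_num) (by norm_num)
    refine this.congr fun n => ?_
    rw [zpow_neg, zpow_natCast, one_div, inv_pow]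
  have hconn : ∀ C : Set (EuclideanSpace ℝ (Fin d)), IsCompact C → IsPreconnected C → x₀ ∈ C →
      C ⊆ Ω → ∀ᶠ n in atTop, C ⊆ P n := by
    intro C hC hCc hxC hCΩ
    obtain ⟨y, hyC, hymin⟩ := hC.exists_isMinOn ⟨x₀, hxC⟩
      (f := fun y => infDist y (frontier Ω)) (continuous_infDist_pt _).continuousOn
    have hpos : 0 < infDist y (frontier Ω) := by
      refine (isClosed_frontier.notMem_iff_infDist_pos hfrne).1 ?_
      intro hy
      rw [hΩopen.frontier_eq] at hy
      exact hy.2 (hCΩ hyC)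
    filter_upwards [hpow.eventually (gt_mem_nhds hpos)] with n hn
    refine hCc.subset_of_closure_inter_subset (hPopen n) ⟨x₀, hxC, hx₀P n⟩ ?_
    rintro z ⟨hz1, hz2⟩
    by_contra hz3
    have hzf : z ∈ frontier (P n) := by rw [(hPopen n).frontier_eq]; exact ⟨hz1, hz3⟩
    have h1 := hPfr n z hzf
    have h2 : infDist y (frontier Ω) ≤ infDist z (frontier Ω) := hymin hz2
    linarith
  have hpath := hΩopen.isConnected_iff_isPathConnected.1 hΩconn
  refine hK.induction_on (p := fun s => ∀ᶠ n in atTop, s ⊆ P n) ?_ ?_ ?_ ?_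
  · simp
  · intro s t hst ht
    filter_upwards [ht] with n hn using hst.trans hn
  · intro s t hs ht
    filter_upwards [hs, ht] with n h1 h2 using union_subset h1 h2
  · intro x hx
    obtain ⟨δ, hδ, hball⟩ := nhds_basis_closedBall.mem_iff.1 (hΩopen.mem_nhds (hKΩ hx))
    refine ⟨closedBall x δ, mem_nhdsWithin_of_mem_nhds (closedBall_mem_nhds x hδ), ?_⟩
    have hj := hpath.joinedIn x₀ hx₀ x (hKΩ hx)
    set γ := hj.somePath
    have := hconn (range γ ∪ closedBall x δ)
      ((isCompact_range γ.continuous).union (isCompact_closedBall x δ))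
      ((isPreconnected_range γ.continuous).union x ⟨1, γ.target⟩ (mem_closedBall_self hδ.le)
        (convex_closedBall x δ).isPreconnected) (Or.inl ⟨0, γ.source⟩)
      (union_subset (by rintro _ ⟨t, rfl⟩; exact hj.somePath_mem t) hball)
    filter_upwards [this] with n hn using subset_union_right.trans hn

theorem tietze {d : ℕ} {S : Set (EuclideanSpace ℝ (Fin d))} (hS : IsClosed S)
    {h : EuclideanSpace ℝ (Fin d) → ℝ} (hh : ContinuousOn h S) :
    ∃ F : EuclideanSpace ℝ (Fin d) → ℝ, Continuous F ∧ ∀ x ∈ S, F x = h x := by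
  obtain ⟨F, hF⟩ := ContinuousMap.exists_restrict_eq hS ⟨S.domRestrict h, hh.domRestrict⟩
  refine ⟨F, F.continuous, fun x hx => ?_⟩
  exact congrArg (fun k : C(S, ℝ) => k ⟨x, hx⟩) hF

theorem HarmonicOnE.congr_local {d : ℕ} {u v : EuclideanSpace ℝ (Fin d) → ℝ}
    {s : Set (EuclideanSpace ℝ (Fin d))} (hs : IsOpen s) (hu : HarmonicOnE u s)
    (h : ∀ x ∈ s, v x = u x) {x : EuclideanSpace ℝ (Fin d)} (hx : x ∈ s) :
    ContDiffAt ℝ 2 v x ∧ lapl v x = 0 := by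
  have he : v =ᶠ[𝓝 x] u := by
    filter_upwards [hs.mem_nhds hx] with y hy using h y hy
  exact ⟨(hu.1.contDiffAt (hs.mem_nhds hx)).congr_of_eventuallyEq he,
    (lapl_congr he).trans (hu.2 x hx)⟩

theorem main_sub (d : ℕ) (hd : 0 < d)
    (Ω : Set (EuclideanSpace ℝ (Fin d))) (hΩopen : IsOpen Ω)
    (hΩbdd : Bornology.IsBounded Ω) (hΩconn : IsConnected Ω)
    (x₀ : EuclideanSpace ℝ (Fin d)) (hx₀ : x₀ ∈ Ω)
    -- the interior approximation (P_n) of (Ω, x₀)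
    (P : ℕ → Set (EuclideanSpace ℝ (Fin d))) (hPopen : ∀ n, IsOpen (P n))
    (hx₀P : ∀ n, x₀ ∈ P n) (hPcl : ∀ n, closure (P n) ⊆ Ω)
    (hPfr : ∀ n, ∀ y ∈ frontier (P n), Metric.infDist y (frontier Ω) < (2:ℝ) ^ (-(n:ℤ)))
    -- the harmonic measures of the sets P_n, given through solvability of the Dirichlet
    -- problem for continuous boundary data
    (ωP : ℕ → EuclideanSpace ℝ (Fin d) → Measure (EuclideanSpace ℝ (Fin d)))
    (hωPprob : ∀ n, ∀ z ∈ P n, IsProbabilityMeasure (ωP n z))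
    (hωPsupp : ∀ n, ∀ z ∈ P n, ωP n z (frontier (P n))ᶜ = 0)
    (hωPdirichlet : ∀ n, ∀ g : EuclideanSpace ℝ (Fin d) → ℝ, Continuous g →
      HarmonicOnE (fun z => ∫ w, g w ∂ (ωP n z)) (P n) ∧
      ∀ ζ ∈ frontier (P n),
        Filter.Tendsto (fun z => ∫ w, g w ∂ (ωP n z)) (nhdsWithin ζ (P n)) (nhds (g ζ)))
    -- the harmonic measure of Ω, given through the least-harmonic-majorant property for
    -- C²-smooth subharmonic functions
    (ω : EuclideanSpace ℝ (Fin d) → Measure (EuclideanSpace ℝ (Fin d)))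
    (hωprob : ∀ z ∈ Ω, IsProbabilityMeasure (ω z))
    (hωsupp : ∀ z ∈ Ω, ω z (frontier Ω)ᶜ = 0)
    (hωmaj : ∀ g : EuclideanSpace ℝ (Fin d) → ℝ, ContDiff ℝ 2 g → (∀ x, 0 ≤ lapl g x) →
      HarmonicOnE (fun z => ∫ w, g w ∂ (ω z)) Ω ∧
      (∀ z ∈ Ω, g z ≤ ∫ w, g w ∂ (ω z)) ∧
      (∀ v : EuclideanSpace ℝ (Fin d) → ℝ, HarmonicOnE v Ω → (∀ z ∈ Ω, g z ≤ v z) →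
        ∀ z ∈ Ω, (∫ w, g w ∂ (ω z)) ≤ v z))
    (g : EuclideanSpace ℝ (Fin d) → ℝ) (hg : ContDiff ℝ 2 g) (hgs : ∀ x, 0 ≤ lapl g x) :
    ∀ x ∈ Ω, Filter.Tendsto (fun n => ∫ w, g w ∂ (ωP n x)) Filter.atTop
      (nhds (∫ w, g w ∂ (ω x))) := by
  obtain ⟨hGh, hgG, hGleast⟩ := hωmaj g hg hgs
  set G : EuclideanSpace ℝ (Fin d) → ℝ := fun z => ∫ w, g w ∂ (ω z) with hG
  set Gn : ℕ → EuclideanSpace ℝ (Fin d) → ℝ := fun n z => ∫ w, g w ∂ (ωP n z) with hGn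
  have hPΩ : ∀ n, P n ⊆ Ω := fun n => subset_closure.trans (hPcl n)
  have hPb : ∀ n, Bornology.IsBounded (P n) := fun n => hΩbdd.subset (hPΩ n)
  have hPcomp : ∀ n, IsCompact (closure (P n)) := fun n => (hPb n).isCompact_closure
  have hex : ∀ K : Set (EuclideanSpace ℝ (Fin d)), IsCompact K → K ⊆ Ω →
      ∀ᶠ n in atTop, K ⊆ P n := fun K hK hKΩ =>
    exhaust hd hΩopen hΩbdd hΩconn hx₀ hPopen hx₀P hPfr hK hKΩ
  have hexpt : ∀ z ∈ Ω, ∀ᶠ n in atTop, z ∈ P n := fun z hz => by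
    filter_upwards [hex {z} isCompact_singleton (by simpa using hz)] with n hn
    exact hn rfl
  have hGnh : ∀ n, HarmonicOnE (Gn n) (P n) := fun n => (hωPdirichlet n g hg.continuous).1
  have hGnb : ∀ n, ∀ ζ ∈ frontier (P n), Tendsto (Gn n) (𝓝[P n] ζ) (𝓝 (g ζ)) :=
    fun n => (hωPdirichlet n g hg.continuous).2
  have hcont : ∀ {u : EuclideanSpace ℝ (Fin d) → ℝ} {s : Set (EuclideanSpace ℝ (Fin d))},
      IsOpen s → ContDiffOn ℝ 2 u s → ∀ ζ ∈ s, ∀ t, Tendsto u (𝓝[t] ζ) (𝓝 (u ζ)) := by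
    intro u s hs hu ζ hζ t
    exact ((hu.contDiffAt (hs.mem_nhds hζ)).continuousAt.tendsto).mono_left nhdsWithin_le_nhds
  -- (a)
  have ha : ∀ n, ∀ z ∈ P n, g z ≤ Gn n z := by
    intro n
    refine comparison hd (hPopen n) (hPb n) hg.contDiffOn (hGnh n).1 ?_ ?_
    · intro x hx
      rw [(hGnh n).2 x hx]; exact hgs x
    · intro ζ hζ
      exact ⟨g ζ, g ζ, le_rfl, (hg.continuous.tendsto ζ).mono_left nhdsWithin_le_nhds,
        hGnb n ζ hζ⟩
  have hfrΩ : ∀ n, frontier (P n) ⊆ Ω := fun n => frontier_subset_closure.trans (hPcl n)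
  -- (b)
  have hb : ∀ n, ∀ z ∈ P n, Gn n z ≤ G z := by
    intro n
    refine comparison hd (hPopen n) (hPb n) (hGnh n).1 (hGh.1.mono (hPΩ n)) ?_ ?_
    · intro x hx
      rw [(hGnh n).2 x hx, hGh.2 x (hPΩ n hx)]
    · intro ζ hζ
      exact ⟨g ζ, G ζ, hgG ζ (hfrΩ n hζ), hGnb n ζ hζ, hcont hΩopen hGh.1 ζ (hfrΩ n hζ) _⟩
  -- (c)
  have hc : ∀ n m, closure (P n) ⊆ P m → ∀ z ∈ P n, Gn n z ≤ Gn m z := by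
    intro n m hnm
    have hsub : P n ⊆ P m := subset_closure.trans hnm
    refine comparison hd (hPopen n) (hPb n) (hGnh n).1 ((hGnh m).1.mono hsub) ?_ ?_
    · intro x hx
      rw [(hGnh n).2 x hx, (hGnh m).2 x (hsub hx)]
    · intro ζ hζ
      have hζm : ζ ∈ P m := hnm (frontier_subset_closure hζ)
      exact ⟨g ζ, Gn m ζ, ha m ζ hζm, hGnb n ζ hζ, hcont (hPopen m) (hGnh m).1 ζ hζm _⟩
  -- (d)
  obtain ⟨M, hM0, hM⟩ : ∃ M : ℝ, 0 < M ∧ ∀ y ∈ closure Ω, |g y| ≤ M := by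
    obtain ⟨M, hM⟩ := hΩbdd.isCompact_closure.exists_bound_of_continuousOn hg.continuous.continuousOn
    exact ⟨max M 1, by positivity, fun y hy => (hM y hy).trans (le_max_left _ _)⟩
  have hdd : ∀ n, ∀ z ∈ P n, |Gn n z| ≤ M := fun n z hz =>
    prob_abs_le (hωPprob n z hz) (hωPsupp n z hz)
      fun x hx => hM x (subset_closure (hfrΩ n hx))
  -- (e)
  have he : ∀ z ∈ Ω, ∃ l, Tendsto (fun n => Gn n z) atTop (𝓝 l) := by
    intro z hz
    set S : Set ℝ := {a | ∃ n, z ∈ P n ∧ Gn n z = a} with hS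
    have hSb : BddAbove S := ⟨M, by
      rintro a ⟨n, hn, rfl⟩
      exact (abs_le.1 (hdd n z hn)).2⟩
    have hSne : S.Nonempty := by
      obtain ⟨n, hn⟩ := (hexpt z hz).exists
      exact ⟨_, n, hn, rfl⟩
    refine ⟨sSup S, tendsto_order.2 ⟨?_, ?_⟩⟩
    · intro a ha'
      obtain ⟨b, ⟨n, hn, rfl⟩, hlt⟩ := exists_lt_of_lt_csSup hSne ha'
      filter_upwards [hex _ (hPcomp n) (hPcl n)] with m hm
      exact hlt.trans_le (hc n m hm z hn)
    · intro a ha'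
      filter_upwards [hexpt z hz] with m hm
      exact (le_csSup hSb ⟨m, hm, rfl⟩).trans_lt ha'
  choose! v hv using he
  -- (f)
  have hvG : ∀ z ∈ Ω, v z ≤ G z := fun z hz =>
    le_of_tendsto (hv z hz) (by filter_upwards [hexpt z hz] with n hn using hb n z hn)
  have hgv : ∀ z ∈ Ω, g z ≤ v z := fun z hz =>
    ge_of_tendsto (hv z hz) (by filter_upwards [hexpt z hz] with n hn using ha n z hn)
  -- (g)
  have hvc : ContinuousOn v Ω := by
    intro c hcΩ
    refine ContinuousAt.continuousWithinAt ?_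
    obtain ⟨δ, hδ, hball⟩ := nhds_basis_closedBall.mem_iff.1 (hΩopen.mem_nhds hcΩ)
    have hr : 0 < δ / 2 := by positivity
    have h2r : 2 * (δ / 2) = δ := by ring
    have hev := hex _ (isCompact_closedBall c δ) hball
    have hsm : closedBall c (δ / 2) ⊆ closedBall c δ := closedBall_subset_closedBall (by linarith)
    have hle : ∀ p ∈ closedBall c (δ / 2), ∀ q ∈ closedBall c (δ / 2),
        v p - v q ≤ (d + 1) * (M / (δ / 2)) * ‖p - q‖ := by
      intro p hp q hq
      refine le_of_tendsto ((hv p (hball (hsm hp))).sub (hv q (hball (hsm hq)))) ?_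
      filter_upwards [hev] with m hm
      exact harm_lip (hPopen m) (hGnh m) hM0 hr (by rwa [h2r]) (hdd m) hp hq
    have hcc : c ∈ closedBall c (δ / 2) := mem_closedBall_self hr.le
    rw [ContinuousAt, tendsto_iff_dist_tendsto_zero]
    have hlim : Tendsto (fun p => (d + 1) * (M / (δ / 2)) * ‖p - c‖) (𝓝 c) (𝓝 0) := by
      have : Continuous (fun p : EuclideanSpace ℝ (Fin d) => (d + 1) * (M / (δ / 2)) * ‖p - c‖) := by
        fun_prop
      simpa using this.tendsto c
    refine squeeze_zero' (Eventually.of_forall fun _ => dist_nonneg) ?_ hlim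
    filter_upwards [closedBall_mem_nhds c hr] with p hp
    rw [Real.dist_eq, abs_le]
    have h1 := hle p hp c hcc
    have h2 := hle c hcc p hp
    rw [norm_sub_rev] at h2
    constructor <;> linarith
  -- (h)
  have hvn : ∀ n, ∃ H : EuclideanSpace ℝ (Fin d) → ℝ, HarmonicOnE H (P n) ∧
      ∀ z ∈ P n, v z = H z := by
    intro n
    obtain ⟨F, hFc, hF⟩ := tietze (isClosed_frontier (s := P n)) (hvc.mono (hfrΩ n))
    refine ⟨_, (hωPdirichlet n F hFc).1, ?_⟩
    intro z hz
    have hex2 : ∀ m, ∃ Fm : EuclideanSpace ℝ (Fin d) → ℝ, closure (P n) ⊆ P m →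
        Continuous Fm ∧ ∀ ζ ∈ frontier (P n), Fm ζ = Gn m ζ := by
      intro m
      by_cases hm : closure (P n) ⊆ P m
      · obtain ⟨Fm, h1, h2⟩ := tietze (isClosed_frontier (s := P n)) (h := Gn m)
          ((hGnh m).1.continuousOn.mono (frontier_subset_closure.trans hm))
        exact ⟨Fm, fun _ => ⟨h1, h2⟩⟩
      · exact ⟨0, fun h => absurd h hm⟩
    choose Fm hFm using hex2
    have hev := hex _ (hPcomp n) (hPcl n)
    have heq : ∀ m, closure (P n) ⊆ P m → Gn m z = ∫ w, Fm m w ∂ (ωP n z) := by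
      intro m hm
      obtain ⟨h1, h2⟩ := hFm m hm
      obtain ⟨h3, h4⟩ := hωPdirichlet n (Fm m) h1
      have hsub : P n ⊆ P m := subset_closure.trans hm
      refine le_antisymm ?_ ?_
      · refine comparison hd (hPopen n) (hPb n) ((hGnh m).1.mono hsub) h3.1 ?_ ?_ z hz
        · intro x hx
          rw [h3.2 x hx, (hGnh m).2 x (hsub hx)]
        · intro ζ hζ
          exact ⟨Gn m ζ, Fm m ζ, (h2 ζ hζ).ge,
            hcont (hPopen m) (hGnh m).1 ζ (hm (frontier_subset_closure hζ)) _, h4 ζ hζ⟩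
      · refine comparison hd (hPopen n) (hPb n) h3.1 ((hGnh m).1.mono hsub) ?_ ?_ z hz
        · intro x hx
          rw [h3.2 x hx, (hGnh m).2 x (hsub hx)]
        · intro ζ hζ
          exact ⟨Fm m ζ, Gn m ζ, (h2 ζ hζ).le, h4 ζ hζ,
            hcont (hPopen m) (hGnh m).1 ζ (hm (frontier_subset_closure hζ)) _⟩
    have hpr := hωPprob n z hz
    have hae : ∀ᵐ w ∂ (ωP n z), w ∈ frontier (P n) := hωPsupp n z hz
    have hlim : Tendsto (fun m => ∫ w, Fm m w ∂ (ωP n z)) atTop (𝓝 (∫ w, F w ∂ (ωP n z))) := by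
      refine tendsto_integral_filter_of_dominated_convergence (fun _ => M) ?_ ?_
        (integrable_const M) ?_
      · filter_upwards [hev] with m hm
        exact (hFm m hm).1.aestronglyMeasurable
      · filter_upwards [hev] with m hm
        filter_upwards [hae] with w hw
        rw [(hFm m hm).2 w hw]
        exact hdd m w (hm (frontier_subset_closure hw))
      · filter_upwards [hae] with w hw
        rw [hF w hw]
        refine (hv w (hfrΩ n hw)).congr' ?_
        filter_upwards [hev] with m hm
        exact ((hFm m hm).2 w hw).symm
    refine tendsto_nhds_unique (hv z (hPΩ n hz)) (hlim.congr' ?_)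
    filter_upwards [hev] with m hm
    exact (heq m hm).symm
  -- (i)
  have hvh : HarmonicOnE v Ω := by
    have : ∀ z ∈ Ω, ContDiffAt ℝ 2 v z ∧ lapl v z = 0 := by
      intro z hz
      obtain ⟨n, hn⟩ := (hexpt z hz).exists
      obtain ⟨H, h1, h2⟩ := hvn n
      exact h1.congr_local (hPopen n) h2 hn
    exact ⟨fun z hz => (this z hz).1.contDiffWithinAt, fun z hz => (this z hz).2⟩
  intro x hx
  have hx1 : v x = G x := le_antisymm (hvG x hx) (hGleast v hvh hgv x hx)
  have := hv x hx
  rwa [hx1] at this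

/-- Harmonic measures of any interior approximation of a bounded connected domain
converge weakly to the harmonic measure of the domain. -/
theorem harmonic_measures_of_interior_approx_converge (d : ℕ)
    (Ω : Set (EuclideanSpace ℝ (Fin d))) (hΩopen : IsOpen Ω)
    (hΩbdd : Bornology.IsBounded Ω) (hΩconn : IsConnected Ω)
    (x₀ : EuclideanSpace ℝ (Fin d)) (hx₀ : x₀ ∈ Ω)
    -- the interior approximation (P_n) of (Ω, x₀)
    (P : ℕ → Set (EuclideanSpace ℝ (Fin d))) (hPopen : ∀ n, IsOpen (P n))
    (hx₀P : ∀ n, x₀ ∈ P n) (hPcl : ∀ n, closure (P n) ⊆ Ω)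
    (hPfr : ∀ n, ∀ y ∈ frontier (P n), Metric.infDist y (frontier Ω) < (2:ℝ) ^ (-(n:ℤ)))
    -- the harmonic measures of the sets P_n, given through solvability of the Dirichlet
    -- problem for continuous boundary data
    (ωP : ℕ → EuclideanSpace ℝ (Fin d) → Measure (EuclideanSpace ℝ (Fin d)))
    (hωPprob : ∀ n, ∀ z ∈ P n, IsProbabilityMeasure (ωP n z))
    (hωPsupp : ∀ n, ∀ z ∈ P n, ωP n z (frontier (P n))ᶜ = 0)
    (hωPdirichlet : ∀ n, ∀ g : EuclideanSpace ℝ (Fin d) → ℝ, Continuous g →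
      HarmonicOnE (fun z => ∫ w, g w ∂ (ωP n z)) (P n) ∧
      ∀ ζ ∈ frontier (P n),
        Filter.Tendsto (fun z => ∫ w, g w ∂ (ωP n z)) (nhdsWithin ζ (P n)) (nhds (g ζ)))
    -- the harmonic measure of Ω, given through the least-harmonic-majorant property for
    -- C²-smooth subharmonic functions
    (ω : EuclideanSpace ℝ (Fin d) → Measure (EuclideanSpace ℝ (Fin d)))
    (hωprob : ∀ z ∈ Ω, IsProbabilityMeasure (ω z))
    (hωsupp : ∀ z ∈ Ω, ω z (frontier Ω)ᶜ = 0)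
    (hωmaj : ∀ g : EuclideanSpace ℝ (Fin d) → ℝ, ContDiff ℝ 2 g → (∀ x, 0 ≤ lapl g x) →
      HarmonicOnE (fun z => ∫ w, g w ∂ (ω z)) Ω ∧
      (∀ z ∈ Ω, g z ≤ ∫ w, g w ∂ (ω z)) ∧
      (∀ v : EuclideanSpace ℝ (Fin d) → ℝ, HarmonicOnE v Ω → (∀ z ∈ Ω, g z ≤ v z) →
        ∀ z ∈ Ω, (∫ w, g w ∂ (ω z)) ≤ v z))
    -- conclusion: weak convergence at every x ∈ Ω
    (x : EuclideanSpace ℝ (Fin d)) (hx : x ∈ Ω)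
    (f : EuclideanSpace ℝ (Fin d) → ℝ) (hf : Continuous f) :
    Filter.Tendsto (fun n => ∫ w, f w ∂ (ωP n x)) Filter.atTop
      (nhds (∫ w, f w ∂ (ω x))) := by
  rcases Nat.eq_zero_or_pos d with hd | hd
  · subst hd
    exfalso
    have h1 := hωsupp x₀ hx₀
    have h2 := hωprob x₀ hx₀
    have h3 : frontier Ω = ∅ := by
      have : Ω = univ := Subsingleton.eq_univ_of_nonempty ⟨x₀, hx₀⟩
      rw [this, frontier_univ]
    rw [h3, compl_empty, measure_univ] at h1
    exact one_ne_zero h1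
  have hmain := main_sub d hd Ω hΩopen hΩbdd hΩconn x₀ hx₀ P hPopen hx₀P hPcl hPfr ωP hωPprob
    hωPsupp hωPdirichlet ω hωprob hωsupp hωmaj
  have hfrb : ∀ n, frontier (P n) ⊆ closure Ω := fun n =>
    (frontier_subset_closure.trans (hPcl n)).trans subset_closure
  have hev : ∀ᶠ n in atTop, x ∈ P n := by
    filter_upwards [exhaust hd hΩopen hΩbdd hΩconn hx₀ hPopen hx₀P hPfr
      (isCompact_singleton (x := x)) (by simpa using hx)] with n hn
    exact hn rfl
  have hclb : Bornology.IsBounded (closure Ω) := hΩbdd.closure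
  have key : ∀ (μ : Measure (EuclideanSpace ℝ (Fin d))) (S : Set (EuclideanSpace ℝ (Fin d)))
      (_ : IsProbabilityMeasure μ) (_ : μ Sᶜ = 0) (_ : S ⊆ closure Ω)
      (g₁ g₂ : EuclideanSpace ℝ (Fin d) → ℝ) (_ : Continuous g₁) (_ : Continuous g₂) (ε : ℝ)
      (_ : ∀ x ∈ closure Ω, |f x - (g₁ x - g₂ x)| ≤ ε),
      |∫ w, f w ∂μ - (∫ w, g₁ w ∂μ - ∫ w, g₂ w ∂μ)| ≤ ε := by
    intro μ S hμ hS hSΩ g₁ g₂ h1 h2 ε hε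
    have hSb := hclb.subset hSΩ
    have i1 := prob_integrable hμ hS hSb h1
    have i2 := prob_integrable hμ hS hSb h2
    have i3 := prob_integrable hμ hS hSb hf
    have i4 : Integrable (fun w => g₁ w - g₂ w) μ := i1.sub i2
    rw [← integral_sub i1 i2, ← integral_sub i3 i4]
    exact prob_abs_le hμ hS fun y hy => hε y (hSΩ hy)
  rw [Metric.tendsto_nhds]
  intro ε hε
  obtain ⟨g₁, g₂, c1, c2, s1, s2, hap⟩ := approx_sub hclb hf (ε := ε / 4) (by positivity)
  have t12 := (hmain g₁ c1 s1 x hx).sub (hmain g₂ c2 s2 x hx)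
  have t3 := Metric.tendsto_nhds.1 t12 (ε / 4) (by positivity)
  filter_upwards [t3, hev] with n hn hxn
  have k1 := key _ _ (hωPprob n x hxn) (hωPsupp n x hxn) (hfrb n) g₁ g₂ c1.continuous
    c2.continuous _ hap
  have k2 := key _ _ (hωprob x hx) (hωsupp x hx) frontier_subset_closure g₁ g₂ c1.continuous
    c2.continuous _ hap
  rw [Real.dist_eq] at hn ⊢
  rw [abs_le] at k1 k2
  rw [abs_lt] at hn ⊢
  constructor <;> linarith [k1.1, k1.2, k2.1, k2.2, hn.1, hn.2]
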